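/- Fix an integer k ≥ 2 and positive reals K, c̄, z̄, Q, B₀ with z̄ > 1. There exist constants C₁ > 0 and C₂ > 0, depending only on k, K, c̄, z̄, Q and B₀, with the following property. Let M ≥ 2 and N ≥ 1 be integers, σ > 0 with σ² > h_M²/N, α = c̄·σ²/N, Ỹ_1,…,Ỹ_M ∈ ℝ, and let y : [0,1] → ℝ be k times continuously differentiable with |y'(x)| ≤ Q on [0,1] and ‖y^{(k)}‖ ≤ B₀. Suppose Δ_M² ≤ z̄·σ²/N, and let f_* : [0,1] → ℝ be k times continuously differentiable with f_*(0) = y(0), f_*(1) = y(1), and Φ(f_*) ≤ Φ(y). Set e = f_* − y, and assume ‖e‖^{2(k−1)/k} ≤ 1 and that the interpolation inequality ‖e'‖² ≤ K·(‖e^{(k)}‖² + 1)·‖e‖^{2(k−1)/k} holds. Then ‖e'‖ ≤ C₁·h_M^{k−1} + C₂·(σ²/N)^{(k−1)/(2k)}. -/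

import Mathlib

open MeasureTheory Set

/-- The average of `f` over the `i`-th subinterval `[(i-1)/M, i/M]`. -/
noncomputable def intervalAvg (M : ℕ) (f : ℝ → ℝ) (i : ℕ) : ℝ :=
  (M : ℝ) * ∫ x in (((i : ℝ) - 1) / M)..((i : ℝ) / M), f x

/-- The Tikhonov functional `Φ`. -/
noncomputable def tikhonov (M k : ℕ) (α : ℝ) (Ytil : ℕ → ℝ) (f : ℝ → ℝ) : ℝ :=
  (1 / M) * ∑ i ∈ Finset.Icc 1 M, (Ytil i - intervalAvg M f i) ^ 2
    + α * ∫ x in (0:ℝ)..1, (iteratedDerivWithin k f (Icc 0 1) x) ^ 2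

/-- The exact group means `Y_i = (1/N) ∑_{j=(i−1)N+1}^{iN} y(ĵ/(MN))`. -/
noncomputable def groupMean (M N : ℕ) (y : ℝ → ℝ) (i : ℕ) : ℝ :=
  (1 / N) * ∑ j ∈ Finset.Icc ((i - 1) * N + 1) (i * N), y ((j : ℝ) / (M * N))

/-- The statistic `Δ_M² = (1/M) ∑_{i=1}^M (Ỹ_i − Y_i)²`. -/
noncomputable def deltaSq (M N : ℕ) (Ytil : ℕ → ℝ) (y : ℝ → ℝ) : ℝ :=
  (1 / M) * ∑ i ∈ Finset.Icc 1 M, (Ytil i - groupMean M N y i) ^ 2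

/-- The `L²(0,1)` norm. -/
noncomputable def l2norm (g : ℝ → ℝ) : ℝ :=
  Real.sqrt (∫ x in (0:ℝ)..1, g x ^ 2)


theorem sq_intervalIntegral_le {a b : ℝ} (hab : a ≤ b) {g : ℝ → ℝ} (hg : ContinuousOn g (Icc a b)) :
    (∫ x in a..b, g x) ^ 2 ≤ (b - a) * ∫ x in a..b, g x ^ 2 := by
  rcases hab.eq_or_lt with rfl | hlt
  · simp
  have hgi : IntervalIntegrable g volume a b := hg.intervalIntegrable_of_Icc hab
  have hg2 : IntervalIntegrable (fun x => g x ^ 2) volume a b :=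
    (hg.pow 2).intervalIntegrable_of_Icc hab
  set I := ∫ x in a..b, g x with hI
  have h0 : 0 ≤ ∫ x in a..b, ((b - a) * g x - I) ^ 2 :=
    intervalIntegral.integral_nonneg hab fun x _ => sq_nonneg _
  have h1 : ∫ x in a..b, ((b - a) * g x - I) ^ 2
      = (b - a) * ((b - a) * (∫ x in a..b, g x ^ 2) - I ^ 2) := by
    have : ∀ x, ((b - a) * g x - I) ^ 2
        = (b - a) ^ 2 * g x ^ 2 - 2 * (b - a) * I * g x + I ^ 2 := fun x => by ring
    simp_rw [this]
    rw [intervalIntegral.integral_add ((hg2.const_mul _).sub (hgi.const_mul _)) (by simp),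
      intervalIntegral.integral_sub (hg2.const_mul _) (hgi.const_mul _),
      intervalIntegral.integral_const_mul, intervalIntegral.integral_const_mul,
      intervalIntegral.integral_const, smul_eq_mul, ← hI]
    ring
  rw [h1] at h0
  linarith [nonneg_of_mul_nonneg_right h0 (sub_pos.2 hlt)]

theorem abs_sub_le_intervalIntegral_abs_deriv {a b : ℝ} {f f' : ℝ → ℝ}
    (hf : ContinuousOn f (Icc a b)) (hf' : ContinuousOn f' (Icc a b))
    (hd : ∀ x ∈ Ioo a b, HasDerivAt f (f' x) x) {u v : ℝ} (hu : u ∈ Icc a b) (hv : v ∈ Icc a b) :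
    |f v - f u| ≤ ∫ x in a..b, |f' x| := by
  wlog huv : u ≤ v generalizing u v
  · rw [abs_sub_comm]
    exact this hv hu (le_of_not_ge huv)
  have hsub : Icc u v ⊆ Icc a b := Icc_subset_Icc hu.1 hv.2
  rw [← intervalIntegral.integral_eq_sub_of_hasDerivAt_of_le huv (hf.mono hsub)
    (fun x hx => hd x (Ioo_subset_Ioo hu.1 hv.2 hx))
    ((hf'.mono hsub).intervalIntegrable_of_Icc huv)]
  refine (intervalIntegral.abs_integral_le_integral_abs huv).trans ?_
  exact intervalIntegral.integral_mono_interval hu.1 huv hv.2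
    (Filter.Eventually.of_forall fun x => abs_nonneg _)
    (hf'.abs.intervalIntegrable_of_Icc (hu.1.trans hu.2))

/-- A Poincaré inequality on one cell. -/
theorem intervalIntegral_sq_le_average {a b : ℝ} (hab : a < b) {f f' : ℝ → ℝ}
    (hf : ContinuousOn f (Icc a b)) (hf' : ContinuousOn f' (Icc a b))
    (hd : ∀ x ∈ Ioo a b, HasDerivAt f (f' x) x) :
    ∫ x in a..b, f x ^ 2 ≤ 2 * (b - a) * ((b - a)⁻¹ * ∫ x in a..b, f x) ^ 2
      + 2 * (b - a) ^ 2 * ∫ x in a..b, f' x ^ 2 := by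
  have hL : 0 < b - a := sub_pos.2 hab
  set A := (b - a)⁻¹ * ∫ x in a..b, f x with hA
  set V := ∫ x in a..b, |f' x|
  set D := ∫ x in a..b, f' x ^ 2
  have hVD : V ^ 2 ≤ (b - a) * D := by
    simpa only [sq_abs] using sq_intervalIntegral_le hab.le hf'.abs
  have hdev : ∀ x ∈ Icc a b, |f x - A| ≤ V := by
    intro x hx
    have h1 : ‖∫ t in a..b, (f x - f t)‖ ≤ V * |b - a| := by
      refine intervalIntegral.norm_integral_le_of_norm_le_const fun t ht => ?_
      rw [uIoc_of_le hab.le] at ht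
      exact abs_sub_le_intervalIntegral_abs_deriv hf hf' hd (Ioc_subset_Icc_self ht) hx
    rw [intervalIntegral.integral_sub (by simp) (hf.intervalIntegrable_of_Icc hab.le),
      intervalIntegral.integral_const, smul_eq_mul, Real.norm_eq_abs, abs_of_pos hL] at h1
    have h2 : (b - a) * f x - ∫ t in a..b, f t = (b - a) * (f x - A) := by
      rw [hA]; field_simp
    rw [h2, abs_mul, abs_of_pos hL, mul_comm V] at h1
    exact le_of_mul_le_mul_left h1 hL
  have hpt : ∀ x ∈ Icc a b, f x ^ 2 ≤ 2 * A ^ 2 + 2 * ((b - a) * D) := by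
    intro x hx
    have h1 := sq_le_sq' (neg_le_of_abs_le (hdev x hx)) (le_of_abs_le (hdev x hx))
    nlinarith [sq_nonneg (f x - 2 * A)]
  calc ∫ x in a..b, f x ^ 2 ≤ ∫ _ in a..b, (2 * A ^ 2 + 2 * ((b - a) * D)) :=
        intervalIntegral.integral_mono_on hab.le ((hf.pow 2).intervalIntegrable_of_Icc hab.le)
          (by simp) hpt
    _ = _ := by rw [intervalIntegral.integral_const, smul_eq_mul]; ring

theorem cell_subset_Icc {P : ℝ} (hP : 0 < P) {i : ℕ} (hi : 1 ≤ i) (hiP : (i : ℝ) ≤ P) :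
    Icc (((i : ℝ) - 1) / P) ((i : ℝ) / P) ⊆ Icc 0 1 := by
  have : (1 : ℝ) ≤ i := by exact_mod_cast hi
  exact Icc_subset_Icc (div_nonneg (by linarith) hP.le) ((div_le_one hP).2 hiP)

theorem sum_cell_integral {P : ℝ} (hP : 0 < P) {m n : ℕ} (hmn : m ≤ n) (hn : (n : ℝ) ≤ P)
    {g : ℝ → ℝ} (hg : ContinuousOn g (Icc 0 1)) :
    ∑ i ∈ Finset.Icc (m + 1) n, ∫ x in (((i : ℝ) - 1) / P)..((i : ℝ) / P), g x
      = ∫ x in ((m : ℝ) / P)..((n : ℝ) / P), g x := by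
  have h := intervalIntegral.sum_integral_adjacent_intervals_Ico (f := g) (μ := volume)
    (a := fun i : ℕ => (i : ℝ) / P) hmn (by
      intro i hi
      have h1 : ((i + 1 : ℕ) : ℝ) ≤ P := le_trans (by exact_mod_cast hi.2) hn
      have h2 := cell_subset_Icc hP (Nat.le_add_left 1 i) h1
      rw [show ((i + 1 : ℕ) : ℝ) - 1 = i by push_cast; ring] at h2
      exact (hg.mono h2).intervalIntegrable_of_Icc
        (div_le_div_of_nonneg_right (by push_cast; linarith) hP.le))
  rw [← h, show Finset.Icc (m + 1) n = Finset.Ico (m + 1) (n + 1) by ext; simp,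
    ← Finset.sum_Ico_add']
  refine Finset.sum_congr rfl fun i _ => ?_
  rw [show ((i + 1 : ℕ) : ℝ) - 1 = i by push_cast; ring]

theorem hasDerivAt_derivWithin_Icc {f : ℝ → ℝ} {a b : ℝ} (hf : DifferentiableOn ℝ f (Icc a b))
    {x : ℝ} (hx : x ∈ Ioo a b) : HasDerivAt f (derivWithin f (Icc a b) x) x :=
  (hf x (Ioo_subset_Icc_self hx)).hasDerivWithinAt.hasDerivAt (Icc_mem_nhds hx.1 hx.2)

/-- The `L²` norm is controlled by the cell averages and the first derivative. -/
theorem integral_sq_le_intervalAvg {M : ℕ} (hM : 0 < M) {f : ℝ → ℝ}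
    (hf : ContDiffOn ℝ 1 f (Icc 0 1)) :
    ∫ x in (0:ℝ)..1, f x ^ 2 ≤ 2 * ((1 / M) * ∑ i ∈ Finset.Icc 1 M, intervalAvg M f i ^ 2)
      + 2 * (1 / M : ℝ) ^ 2 * ∫ x in (0:ℝ)..1, derivWithin f (Icc 0 1) x ^ 2 := by
  have hP : (0 : ℝ) < M := by exact_mod_cast hM
  have hc := hf.continuousOn
  have hc' := hf.continuousOn_derivWithin (uniqueDiffOn_Icc zero_lt_one) le_rfl
  have hsum : ∀ g : ℝ → ℝ, ContinuousOn g (Icc 0 1) →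
      ∑ i ∈ Finset.Icc 1 M, ∫ x in (((i : ℝ) - 1) / M)..((i : ℝ) / M), g x
        = ∫ x in (0:ℝ)..1, g x := by
    intro g hg
    simpa [hP.ne'] using sum_cell_integral hP (Nat.zero_le M) le_rfl hg
  rw [← hsum (fun x => f x ^ 2) (hc.pow 2),
    ← hsum (fun x => derivWithin f (Icc 0 1) x ^ 2) (hc'.pow 2), Finset.mul_sum, Finset.mul_sum,
    Finset.mul_sum, ← Finset.sum_add_distrib]
  refine Finset.sum_le_sum fun i hi => ?_
  obtain ⟨h1, h2⟩ := Finset.mem_Icc.1 hi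
  have hsub := cell_subset_Icc hP h1 (by exact_mod_cast h2)
  have hlen : (i : ℝ) / M - ((i : ℝ) - 1) / M = 1 / M := by ring
  have hlt : ((i : ℝ) - 1) / M < (i : ℝ) / M := by
    rw [← sub_pos, hlen]; positivity
  have hIoo : Ioo (((i : ℝ) - 1) / M) ((i : ℝ) / M) ⊆ Ioo 0 1 := by
    rw [← interior_Icc, ← interior_Icc]
    exact interior_mono hsub
  have h := intervalIntegral_sq_le_average hlt (hc.mono hsub) (hc'.mono hsub) fun x hx =>
    hasDerivAt_derivWithin_Icc (hf.differentiableOn one_ne_zero) (hIoo hx)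
  rw [hlen, one_div, inv_inv] at h
  simp only [intervalAvg, one_div]
  linarith

/-- Group means approximate cell averages of a Lipschitz function. -/
theorem abs_groupMean_sub_intervalAvg_le {M N : ℕ} (hM : 0 < M) (hN : 0 < N) {y : ℝ → ℝ} {Q : ℝ}
    (hy : DifferentiableOn ℝ y (Icc 0 1)) (hQ : ∀ x ∈ Icc (0:ℝ) 1, |derivWithin y (Icc 0 1) x| ≤ Q)
    {i : ℕ} (hi : i ∈ Finset.Icc 1 M) :
    |groupMean M N y i - intervalAvg M y i| ≤ Q / (M * N) := by
  have hM' : (0 : ℝ) < M := by exact_mod_cast hM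
  have hN' : (0 : ℝ) < N := by exact_mod_cast hN
  have hP : (0 : ℝ) < M * N := mul_pos hM' hN'
  obtain ⟨h1, h2⟩ := Finset.mem_Icc.1 hi
  have hiM : i * N ≤ M * N := Nat.mul_le_mul_right N h2
  have hcast : (((i - 1) * N : ℕ) : ℝ) = ((i : ℝ) - 1) * N := by
    push_cast [Nat.cast_sub h1]; ring
  have hsum := sum_cell_integral hP (m := (i - 1) * N) (n := i * N)
    (Nat.mul_le_mul_right N (Nat.sub_le i 1)) (by exact_mod_cast hiM) hy.continuousOn
  rw [hcast, Nat.cast_mul, mul_div_mul_right _ _ hN'.ne', mul_div_mul_right _ _ hN'.ne'] at hsum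
  have hcell : ∀ j ∈ Finset.Icc ((i - 1) * N + 1) (i * N),
      |1 / (N : ℝ) * y ((j : ℝ) / (M * N))
        - M * ∫ x in (((j : ℝ) - 1) / (M * N))..((j : ℝ) / (M * N)), y x|
        ≤ Q / (M * N) / N := by
    intro j hj
    obtain ⟨hj1, hj2⟩ := Finset.mem_Icc.1 hj
    have hsub := cell_subset_Icc hP (i := j) (by omega) (by exact_mod_cast hj2.trans hiM)
    have hlen : (j : ℝ) / (M * N) - ((j : ℝ) - 1) / (M * N) = 1 / (M * N) := by ring
    have hle : ((j : ℝ) - 1) / (M * N) ≤ (j : ℝ) / (M * N) := by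
      rw [← sub_nonneg, hlen]; positivity
    have hQ0 : 0 ≤ Q := (abs_nonneg _).trans (hQ 0 (by simp))
    have hb : ‖∫ x in (((j : ℝ) - 1) / (M * N))..((j : ℝ) / (M * N)),
        (y ((j : ℝ) / (M * N)) - y x)‖ ≤ Q * (1 / (M * N)) * |1 / ((M : ℝ) * N)| := by
      rw [← hlen]
      refine intervalIntegral.norm_integral_le_of_norm_le_const fun t ht => ?_
      rw [uIoc_of_le hle] at ht
      refine ((convex_Icc (0:ℝ) 1).norm_image_sub_le_of_norm_derivWithin_le hy hQ
        (hsub (Ioc_subset_Icc_self ht)) (hsub (right_mem_Icc.2 hle))).trans ?_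
      gcongr
      rw [Real.norm_eq_abs, abs_of_nonneg (by linarith [ht.2])]
      linarith [ht.1]
    rw [intervalIntegral.integral_sub (by simp)
        ((hy.continuousOn.mono hsub).intervalIntegrable_of_Icc hle),
      intervalIntegral.integral_const, smul_eq_mul, hlen, Real.norm_eq_abs,
      abs_of_pos (show (0 : ℝ) < 1 / (M * N) by positivity)] at hb
    have := mul_le_mul_of_nonneg_left hb hM'.le
    rw [← abs_of_pos hM', ← abs_mul, abs_of_pos hM'] at this
    calc _ = _ := by congr 1; field_simp
      _ ≤ _ := this
      _ = _ := by field_simp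
  rw [groupMean, intervalAvg, ← hsum, Finset.mul_sum, Finset.mul_sum, ← Finset.sum_sub_distrib]
  refine (Finset.abs_sum_le_sum_abs _ _).trans ((Finset.sum_le_sum hcell).trans_eq ?_)
  have hcard : i * N + 1 - ((i - 1) * N + 1) = N := by
    obtain ⟨i, rfl⟩ := Nat.exists_eq_add_of_le' h1
    simp [Nat.add_mul]
  rw [Finset.sum_const, Nat.card_Icc, hcard, nsmul_eq_mul]
  field_simp

theorem intervalAvg_sub {M : ℕ} (hM : 0 < M) {f g : ℝ → ℝ} (hf : ContinuousOn f (Icc 0 1))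
    (hg : ContinuousOn g (Icc 0 1)) {i : ℕ} (hi : i ∈ Finset.Icc 1 M) :
    intervalAvg M (fun x => f x - g x) i = intervalAvg M f i - intervalAvg M g i := by
  have hP : (0 : ℝ) < M := by exact_mod_cast hM
  obtain ⟨h1, h2⟩ := Finset.mem_Icc.1 hi
  have hsub := cell_subset_Icc hP h1 (by exact_mod_cast h2)
  have hle : ((i : ℝ) - 1) / M ≤ (i : ℝ) / M :=
    div_le_div_of_nonneg_right (by linarith) hP.le
  rw [intervalAvg, intervalIntegral.integral_sub ((hf.mono hsub).intervalIntegrable_of_Icc hle)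
    ((hg.mono hsub).intervalIntegrable_of_Icc hle), mul_sub]
  rfl

theorem l2norm_nonneg (g : ℝ → ℝ) : 0 ≤ l2norm g := Real.sqrt_nonneg _

theorem l2norm_sq (g : ℝ → ℝ) : l2norm g ^ 2 = ∫ x in (0:ℝ)..1, g x ^ 2 :=
  Real.sq_sqrt (intervalIntegral.integral_nonneg zero_le_one fun _ _ => sq_nonneg _)

theorem mean_sq_sub_le {M : ℕ} (u v w : ℕ → ℝ) :
    (1 / M : ℝ) * ∑ i ∈ Finset.Icc 1 M, (u i - w i) ^ 2
      ≤ 2 * ((1 / M : ℝ) * ∑ i ∈ Finset.Icc 1 M, (u i - v i) ^ 2)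
        + 2 * ((1 / M : ℝ) * ∑ i ∈ Finset.Icc 1 M, (v i - w i) ^ 2) := by
  rw [mul_left_comm (2 : ℝ), mul_left_comm (2 : ℝ), ← mul_add,
    Finset.mul_sum _ _ (2 : ℝ), Finset.mul_sum _ _ (2 : ℝ), ← Finset.sum_add_distrib]
  refine mul_le_mul_of_nonneg_left (Finset.sum_le_sum fun i _ => ?_) (by positivity)
  nlinarith [sq_nonneg ((u i - v i) - (v i - w i))]

theorem mean_sq_groupMean_sub_intervalAvg_le {M N : ℕ} (hM : 0 < M) (hN : 0 < N) {y : ℝ → ℝ}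
    {Q : ℝ} (hy : DifferentiableOn ℝ y (Icc 0 1))
    (hQ : ∀ x ∈ Icc (0:ℝ) 1, |derivWithin y (Icc 0 1) x| ≤ Q) :
    (1 / M : ℝ) * ∑ i ∈ Finset.Icc 1 M, (groupMean M N y i - intervalAvg M y i) ^ 2
      ≤ (Q / (M * N)) ^ 2 := by
  have hM' : (0 : ℝ) < M := by exact_mod_cast hM
  have h : ∑ i ∈ Finset.Icc 1 M, (groupMean M N y i - intervalAvg M y i) ^ 2
      ≤ ∑ _i ∈ Finset.Icc 1 M, (Q / (M * N)) ^ 2 := by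
    refine Finset.sum_le_sum fun i hi => ?_
    have := abs_groupMean_sub_intervalAvg_le hM hN hy hQ hi
    exact sq_le_sq' (neg_le_of_abs_le this) (le_of_abs_le this)
  rw [Finset.sum_const, Nat.card_Icc, nsmul_eq_mul, Nat.add_sub_cancel] at h
  rw [one_div, inv_mul_le_iff₀ hM']
  exact h

theorem l2norm_iteratedDerivWithin_sub_sq_le {k : ℕ} {f g : ℝ → ℝ}
    (hf : ContDiffOn ℝ k f (Icc 0 1)) (hg : ContDiffOn ℝ k g (Icc 0 1)) :
    l2norm (iteratedDerivWithin k (fun x => f x - g x) (Icc 0 1)) ^ 2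
      ≤ 2 * l2norm (iteratedDerivWithin k f (Icc 0 1)) ^ 2
        + 2 * l2norm (iteratedDerivWithin k g (Icc 0 1)) ^ 2 := by
  have hu : UniqueDiffOn ℝ (Icc (0:ℝ) 1) := uniqueDiffOn_Icc zero_lt_one
  have hintegrable : ∀ u : ℝ → ℝ, ContDiffOn ℝ k u (Icc 0 1) →
      IntervalIntegrable (fun x => iteratedDerivWithin k u (Icc 0 1) x ^ 2) volume 0 1 := fun u h =>
    ((h.continuousOn_iteratedDerivWithin le_rfl hu).pow 2).intervalIntegrable_of_Icc zero_le_one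
  have hcf := (hintegrable f hf).const_mul 2
  have hcg := (hintegrable g hg).const_mul 2
  simp only [l2norm_sq]
  rw [← intervalIntegral.integral_const_mul, ← intervalIntegral.integral_const_mul,
    ← intervalIntegral.integral_add hcf hcg]
  refine intervalIntegral.integral_mono_on zero_le_one (hintegrable _ (hf.sub hg))
    (hcf.add hcg) fun x hx => ?_
  rw [show (fun x => f x - g x) = f - g from rfl,
    iteratedDerivWithin_sub hx hu (hf x hx) (hg x hx)]
  nlinarith [sq_nonneg (iteratedDerivWithin k f (Icc 0 1) x + iteratedDerivWithin k g (Icc 0 1) x)]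

/-- Absorbing the derivative term in the interpolation inequality. -/
theorem le_of_interpolation {k : ℕ} (hk : 2 ≤ k) {E B h s n x : ℝ} (hE : 0 < E) (hB : 0 < B)
    (hh : 0 ≤ h) (hs : 0 < s) (hn : 0 ≤ n) (hx : 0 ≤ x)
    (hinterp : x ^ 2 ≤ E * n ^ (2 * ((k : ℝ) - 1) / k)) (hn2 : n ^ 2 ≤ B * s + 2 * h ^ 2 * x ^ 2) :
    x ≤ Real.sqrt (E ^ k) * 2 ^ (k - 1) * h ^ (k - 1)
      + Real.sqrt (E * (2 * B) ^ (((k : ℝ) - 1) / k)) * s ^ (((k : ℝ) - 1) / (2 * k)) := by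
  have hk0 : (0 : ℝ) < k := by exact_mod_cast (by omega : 0 < k)
  have hk1 : (1 : ℝ) ≤ k := by exact_mod_cast (by omega : 1 ≤ k)
  set p : ℝ := ((k : ℝ) - 1) / k with hp
  have hp0 : 0 ≤ p := div_nonneg (by linarith) hk0.le
  have hnp : n ^ (2 * ((k : ℝ) - 1) / k) = (n ^ 2) ^ p := by
    rw [mul_div_assoc, Real.rpow_mul hn, Real.rpow_two]
  rw [hnp] at hinterp
  have ht1 : 0 ≤ Real.sqrt (E ^ k) * 2 ^ (k - 1) * h ^ (k - 1) := by positivity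
  have ht2 : 0 ≤ Real.sqrt (E * (2 * B) ^ p) * s ^ (((k : ℝ) - 1) / (2 * k)) := by positivity
  rcases le_total (B * s) (2 * h ^ 2 * x ^ 2) with hcase | hcase
  · rcases hx.eq_or_lt with rfl | hxpos
    · linarith
    refine le_add_of_le_of_nonneg ?_ ht2
    have h1 : x ^ 2 ≤ E * ((2 * h * x) ^ 2) ^ p :=
      hinterp.trans (by
        have : n ^ 2 ≤ (2 * h * x) ^ 2 := by linear_combination hn2 + hcase
        gcongr)
    have h2 : (x ^ 2) ^ k ≤ E ^ k * ((2 * h * x) ^ 2) ^ (k - 1) := by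
      calc (x ^ 2) ^ k ≤ (E * ((2 * h * x) ^ 2) ^ p) ^ k := by gcongr
        _ = _ := by
          rw [mul_pow, ← Real.rpow_mul_natCast (by positivity), hp, div_mul_cancel₀ _ hk0.ne',
            ← Real.rpow_natCast _ (k - 1), Nat.cast_sub (by omega), Nat.cast_one]
    have h3 : x ^ 2 ≤ E ^ k * (2 ^ (k - 1) * h ^ (k - 1)) ^ 2 := by
      refine le_of_mul_le_mul_right ?_ (show 0 < (x ^ 2) ^ (k - 1) by positivity)
      calc x ^ 2 * (x ^ 2) ^ (k - 1) = (x ^ 2) ^ k := by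
            rw [← pow_succ', Nat.sub_add_cancel (by omega)]
        _ ≤ _ := h2
        _ = _ := by rw [mul_pow (2 * h) x, mul_pow _ (x ^ 2), pow_right_comm (2 * h), mul_pow 2 h,
            mul_assoc]
    have h4 := Real.le_sqrt_of_sq_le h3
    rwa [Real.sqrt_mul (by positivity), Real.sqrt_sq (by positivity), ← mul_assoc] at h4
  · refine le_add_of_nonneg_of_le ht1 ?_
    have h1 : x ^ 2 ≤ E * (2 * B) ^ p * (s ^ (((k : ℝ) - 1) / (2 * k))) ^ 2 := by
      calc x ^ 2 ≤ E * (2 * B * s) ^ p := hinterp.trans (by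
        have : n ^ 2 ≤ 2 * B * s := by linear_combination hn2 + hcase
        gcongr)
        _ = _ := by
          rw [Real.mul_rpow (by positivity) hs.le, ← Real.rpow_mul_natCast hs.le, mul_assoc, hp]
          congr 3
          push_cast
          field_simp
    have h4 := Real.le_sqrt_of_sq_le h1
    rwa [Real.sqrt_mul (by positivity), Real.sqrt_sq (by positivity)] at h4

/-- Convergence rate for the first derivative: under the parameter choice
`α = c̄σ²/N`, the high-probability bound `Δ_M² ≤ z̄σ²/N`, the condition
`σ² > h_M²/N`, and the Sobolev interpolation inequality for `e = f_* − y`,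
there are constants `C₁, C₂` (depending only on `k, K, c̄, z̄, Q, B₀`) with
`‖e'‖ ≤ C₁·h_M^{k−1} + C₂·(σ²/N)^{(k−1)/(2k)}`. -/
theorem first_derivative_convergence_rate (k : ℕ) (hk : 2 ≤ k)
    (K cbar zbar Q B₀ : ℝ) (hK : 0 < K) (hc : 0 < cbar) (hz : 1 < zbar)
    (hQpos : 0 < Q) (hB₀ : 0 < B₀) :
    ∃ C₁ C₂ : ℝ, 0 < C₁ ∧ 0 < C₂ ∧
      ∀ (M N : ℕ), 2 ≤ M → 1 ≤ N →
      ∀ σ : ℝ, 0 < σ → (1 / M : ℝ) ^ 2 / N < σ ^ 2 →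
      ∀ (Ytil : ℕ → ℝ) (y fstar : ℝ → ℝ),
        ContDiffOn ℝ k y (Icc 0 1) →
        (∀ x ∈ Icc (0:ℝ) 1, |derivWithin y (Icc 0 1) x| ≤ Q) →
        l2norm (iteratedDerivWithin k y (Icc 0 1)) ≤ B₀ →
        deltaSq M N Ytil y ≤ zbar * σ ^ 2 / N →
        ContDiffOn ℝ k fstar (Icc 0 1) → fstar 0 = y 0 → fstar 1 = y 1 →
        tikhonov M k (cbar * σ ^ 2 / N) Ytil fstar
          ≤ tikhonov M k (cbar * σ ^ 2 / N) Ytil y →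
        ∀ e : ℝ → ℝ, (∀ x, e x = fstar x - y x) →
        l2norm e ^ (2 * ((k : ℝ) - 1) / k) ≤ 1 →
        l2norm (derivWithin e (Icc 0 1)) ^ 2
          ≤ K * (l2norm (iteratedDerivWithin k e (Icc 0 1)) ^ 2 + 1)
            * l2norm e ^ (2 * ((k : ℝ) - 1) / k) →
        l2norm (derivWithin e (Icc 0 1))
          ≤ C₁ * (1 / M : ℝ) ^ (k - 1)
            + C₂ * (σ ^ 2 / N) ^ (((k : ℝ) - 1) / (2 * k)) := by
  set A : ℝ := 2 * zbar + 2 * Q ^ 2 + cbar * B₀ ^ 2 with hA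
  have hApos : 0 < A := by positivity
  set E : ℝ := K * (2 * (A / cbar) + 2 * B₀ ^ 2 + 1) with hE
  have hEpos : 0 < E := by positivity
  refine ⟨Real.sqrt (E ^ k) * 2 ^ (k - 1),
    Real.sqrt (E * (2 * (8 * A)) ^ (((k : ℝ) - 1) / k)), by positivity, by positivity, ?_⟩
  intro M N hM hN σ hσ hσM Ytil y f hy hyQ hyB hΔ hf _ _ hΦ e he _ hinterp
  obtain rfl : e = fun x => f x - y x := funext he
  have hM0 : 0 < M := by omega
  have hM' : (0 : ℝ) < M := by exact_mod_cast hM0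
  have hN' : (0 : ℝ) < N := by exact_mod_cast hN
  have hk1 : ((1 : ℕ) : WithTop ℕ∞) ≤ (k : WithTop ℕ∞) := by exact_mod_cast (by omega : 1 ≤ k)
  set s : ℝ := σ ^ 2 / N with hs
  have hspos : 0 < s := by positivity
  rw [mul_div_assoc, ← hs] at hΦ hΔ
  have hy1 : ContDiffOn ℝ 1 y (Icc 0 1) := hy.of_le (by exact_mod_cast hk1)
  have hf1 : ContDiffOn ℝ 1 f (Icc 0 1) := hf.of_le (by exact_mod_cast hk1)
  have hgrid : (Q / (M * N)) ^ 2 ≤ Q ^ 2 * s := by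
    have h1 : (1 / M : ℝ) ^ 2 / N / N ≤ s := div_le_div_of_nonneg_right hσM.le hN'.le
    calc (Q / (M * N)) ^ 2 = Q ^ 2 * ((1 / M : ℝ) ^ 2 / N / N) := by field_simp
      _ ≤ _ := by gcongr
  have hyB2 : l2norm (iteratedDerivWithin k y (Icc 0 1)) ^ 2 ≤ B₀ ^ 2 := by
    have := l2norm_nonneg (iteratedDerivWithin k y (Icc 0 1))
    gcongr
  have hresY := (mean_sq_sub_le (M := M) Ytil (groupMean M N y) (intervalAvg M y)).trans
    (add_le_add (mul_le_mul_of_nonneg_left hΔ zero_le_two) (mul_le_mul_of_nonneg_left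
      ((mean_sq_groupMean_sub_intervalAvg_le hM0 hN
        (hy1.differentiableOn one_ne_zero) hyQ).trans hgrid) zero_le_two))
  simp only [tikhonov, ← l2norm_sq] at hΦ
  have hΦy : cbar * s * l2norm (iteratedDerivWithin k y (Icc 0 1)) ^ 2 ≤ cbar * s * B₀ ^ 2 := by
    gcongr
  have hresf0 : 0 ≤ (1 / M : ℝ) * ∑ i ∈ Finset.Icc 1 M, (Ytil i - intervalAvg M f i) ^ 2 := by
    positivity
  have hpen0 : 0 ≤ cbar * s * l2norm (iteratedDerivWithin k f (Icc 0 1)) ^ 2 := by positivity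
  have hpenY : 0 ≤ cbar * s * B₀ ^ 2 := by positivity
  have hAs : A * s = 2 * (zbar * s) + 2 * (Q ^ 2 * s) + cbar * s * B₀ ^ 2 := by rw [hA]; ring
  have hfk : l2norm (iteratedDerivWithin k f (Icc 0 1)) ^ 2 ≤ A / cbar := by
    rw [le_div_iff₀ hc]
    refine le_of_mul_le_mul_right ?_ hspos
    linarith
  have hek := l2norm_iteratedDerivWithin_sub_sq_le hf hy
  have havg : (1 / M : ℝ) * ∑ i ∈ Finset.Icc 1 M, intervalAvg M (fun x => f x - y x) i ^ 2
      ≤ 4 * A * s := by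
    have h := mean_sq_sub_le (M := M) (intervalAvg M f) Ytil (intervalAvg M y)
    rw [Finset.sum_congr rfl fun i hi => by
      rw [intervalAvg_sub hM0 hf1.continuousOn hy1.continuousOn hi]]
    simp only [fun i => sub_sq_comm (intervalAvg M f i) (Ytil i)] at h
    linarith
  have hpoin := integral_sq_le_intervalAvg hM0 (hf1.sub hy1)
  refine le_of_interpolation (n := l2norm fun x => f x - y x) hk hEpos
    (by positivity) (by positivity) hspos (l2norm_nonneg _) (l2norm_nonneg _) (hinterp.trans ?_) ?_
  · have := l2norm_nonneg fun x => f x - y x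
    rw [hE]
    gcongr
    linarith
  · rw [l2norm_sq, l2norm_sq]
    linarith
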